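/- arXiv:2004.13998 — 3 statements merged into one kernel-verified Lean document; each statement's English description precedes it below -/
import Mathlib

section
/- Let E be a real normed vector space, Θ a nonempty set, g : ℕ → Θ → E, and a : ℕ → ℝ a sequence with ‖g i θ‖ ≤ a i for all i ≥ 1 and all θ ∈ Θ. Assume: (i) there is A ∈ ℝ such that (1/n) ∑_{i=1}^n a i → A as n → ∞; and (ii) there exist r ∈ (1,2) and I : Θ → E such that for every ε > 0, for all sufficiently large n, every integer k with ⌊n^{1/r}⌋ ≤ k ≤ n and every θ ∈ Θ satisfy ‖(1/k) ∑_{i=1}^k g i θ − I θ‖ ≤ ε. Then for every ε > 0, for all sufficiently large n, every integer k with 1 ≤ k ≤ n and every θ ∈ Θ satisfy (1/n) ‖∑_{i=1}^k g i θ − (k/n) • ∑_{i=1}^n g i θ‖ ≤ ε. -/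
open Filter Finset

/-- If the running averages of a dominated family `g` converge to `I` uniformly, then the centred
partial sums grow at most like `k * ε` up to an additive constant, uniformly in the parameter. -/
lemma exists_norm_sum_sub_smul_le
    {E : Type*} [NormedAddCommGroup E] [NormedSpace ℝ E] {Θ : Type*} [Nonempty Θ]
    {g : ℕ → Θ → E} {a : ℕ → ℝ} {I : Θ → E}
    (hbound : ∀ i : ℕ, 1 ≤ i → ∀ θ : Θ, ‖g i θ‖ ≤ a i) {ε : ℝ}
    (hI : ∀ᶠ n : ℕ in atTop, ∀ θ : Θ, ‖(1 / (n : ℝ)) • ∑ i ∈ Icc 1 n, g i θ - I θ‖ ≤ ε) :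
    ∃ C : ℝ, 0 ≤ C ∧ ∀ (k : ℕ) (θ : Θ),
      ‖∑ i ∈ Icc 1 k, g i θ - (k : ℝ) • I θ‖ ≤ k * ε + C := by
  obtain ⟨M, hM⟩ := eventually_atTop.1 (hI.and (eventually_ge_atTop 1))
  have hM1 : (1 : ℝ) ≤ M := by exact_mod_cast (hM M le_rfl).2
  have ha : ∀ i ∈ Icc 1 M, 0 ≤ a i := fun i hi =>
    (norm_nonneg _).trans (hbound i (mem_Icc.1 hi).1 (Classical.arbitrary Θ))
  set B : ℝ := ∑ i ∈ Icc 1 M, a i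
  have hB : 0 ≤ B := sum_nonneg ha
  have hS : ∀ k ≤ M, ∀ θ, ‖∑ i ∈ Icc 1 k, g i θ‖ ≤ B := fun k hk θ =>
    (norm_sum_le_of_le _ fun i hi => hbound i (mem_Icc.1 hi).1 θ).trans
      (sum_le_sum_of_subset_of_nonneg (Icc_subset_Icc_right hk) fun i hi _ => ha i hi)
  have hIB : ∀ θ, ‖I θ‖ ≤ ε + B := fun θ => by
    have havg : ‖(1 / (M : ℝ)) • ∑ i ∈ Icc 1 M, g i θ‖ ≤ B := by
      rw [norm_smul, Real.norm_of_nonneg (by positivity)]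
      exact (mul_le_of_le_one_left (norm_nonneg _) (div_le_one_of_le₀ hM1 (by positivity))).trans
        (hS M le_rfl θ)
    linarith [(hM M le_rfl).1 θ, norm_le_norm_add_norm_sub ((1 / (M : ℝ)) • ∑ i ∈ Icc 1 M, g i θ)
      (I θ)]
  refine ⟨B + M * B, by positivity, fun k θ => ?_⟩
  rcases le_total M k with hk | hk
  · have hk0 : (k : ℝ) ≠ 0 := by
      have := (hM k hk).2
      positivity
    have hsum : ∑ i ∈ Icc 1 k, g i θ - (k : ℝ) • I θ =
        (k : ℝ) • ((1 / (k : ℝ)) • ∑ i ∈ Icc 1 k, g i θ - I θ) := by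
      rw [smul_sub, smul_smul, mul_one_div_cancel hk0, one_smul]
    rw [hsum, norm_smul, Real.norm_natCast]
    have := mul_le_mul_of_nonneg_left ((hM k hk).1 θ) k.cast_nonneg
    have : 0 ≤ B + M * B := by positivity
    linarith
  · have hkM : (k : ℝ) * B ≤ M * B := by gcongr
    have hkI := mul_le_mul_of_nonneg_left (hIB θ) k.cast_nonneg
    have htri := norm_sub_le (∑ i ∈ Icc 1 k, g i θ) ((k : ℝ) • I θ)
    rw [norm_smul, Real.norm_natCast] at htri
    linarith [hS k hk θ]

/-- Deterministic content of Lemma 2: uniform convergence of running averages over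
the range `⌊n^(1/r)⌋ ≤ k ≤ n`, together with Cesàro convergence of a dominating
sequence, forces the normalized cusum quantity to tend to `0` uniformly. -/
theorem cusum_uniform_smallness
    {E : Type*} [NormedAddCommGroup E] [NormedSpace ℝ E]
    {Θ : Type*} [Nonempty Θ] (g : ℕ → Θ → E) (a : ℕ → ℝ)
    (hbound : ∀ i : ℕ, 1 ≤ i → ∀ θ : Θ, ‖g i θ‖ ≤ a i)
    (hA : ∃ A : ℝ, Tendsto (fun n : ℕ => (1 / (n : ℝ)) * ∑ i ∈ Icc 1 n, a i)
      atTop (nhds A))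
    (hI : ∃ r : ℝ, 1 < r ∧ r < 2 ∧ ∃ I : Θ → E, ∀ ε > (0 : ℝ), ∀ᶠ n : ℕ in atTop,
      ∀ k : ℕ, ⌊(n : ℝ) ^ (1 / r)⌋₊ ≤ k → k ≤ n → ∀ θ : Θ,
        ‖(1 / (k : ℝ)) • ∑ i ∈ Icc 1 k, g i θ - I θ‖ ≤ ε) :
    ∀ ε > (0 : ℝ), ∀ᶠ n : ℕ in atTop, ∀ k : ℕ, 1 ≤ k → k ≤ n → ∀ θ : Θ,
      (1 / (n : ℝ)) *
        ‖∑ i ∈ Icc 1 k, g i θ - ((k : ℝ) / (n : ℝ)) • ∑ i ∈ Icc 1 n, g i θ‖ ≤ ε := by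
  obtain ⟨r, hr, -, I, hI⟩ := hI
  intro ε hε
  have hdiag : ∀ᶠ n : ℕ in atTop, ∀ θ : Θ,
      ‖(1 / (n : ℝ)) • ∑ i ∈ Icc 1 n, g i θ - I θ‖ ≤ ε / 4 := by
    filter_upwards [hI (ε / 4) (by positivity), eventually_ge_atTop 1] with n hn hn1
    refine hn n (Nat.floor_le_of_le ?_) le_rfl
    exact Real.rpow_le_self_of_one_le (by exact_mod_cast hn1)
      (div_le_one_of_le₀ hr.le (by linarith))
  obtain ⟨C, hC, hsum⟩ := exists_norm_sum_sub_smul_le hbound hdiag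
  filter_upwards [tendsto_natCast_atTop_atTop.eventually_ge_atTop (4 * C / ε)]
    with n hn k hk hkn θ
  have hn0 : (0 : ℝ) < n := by exact_mod_cast hk.trans hkn
  have hkn' : (k : ℝ) ≤ n := by exact_mod_cast hkn
  have hcenter : ∑ i ∈ Icc 1 k, g i θ - ((k : ℝ) / n) • ∑ i ∈ Icc 1 n, g i θ =
      (∑ i ∈ Icc 1 k, g i θ - (k : ℝ) • I θ) -
        ((k : ℝ) / n) • (∑ i ∈ Icc 1 n, g i θ - (n : ℝ) • I θ) := by
    rw [smul_sub, smul_smul, div_mul_cancel₀ _ hn0.ne']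
    abel
  have htail : ‖((k : ℝ) / n) • (∑ i ∈ Icc 1 n, g i θ - (n : ℝ) • I θ)‖ ≤ n * (ε / 4) + C := by
    rw [norm_smul, Real.norm_of_nonneg (by positivity)]
    exact (mul_le_of_le_one_left (norm_nonneg _) (div_le_one_of_le₀ hkn' hn0.le)).trans (hsum n θ)
  have hhead : (k : ℝ) * (ε / 4) ≤ n * (ε / 4) := by gcongr
  rw [one_div_mul_eq_div, div_le_iff₀ hn0, hcenter]
  rw [div_le_iff₀ hε] at hn
  linarith [hsum k θ, norm_sub_le (∑ i ∈ Icc 1 k, g i θ - (k : ℝ) • I θ)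
    (((k : ℝ) / n) • (∑ i ∈ Icc 1 n, g i θ - (n : ℝ) • I θ))]
end

section
/- Let (Ω, ℱ, μ) be a probability space equipped with a filtration (𝒢 k)_{k∈ℕ}, and let M : ℕ → Ω → ℝ be a martingale with respect to (𝒢 k) and μ such that M 0 = 0 and each M k is square-integrable. Suppose K : ℕ → ℝ satisfies ∑_{i=1}^n ∫ (M i − M (i−1))² dμ ≤ K n for every n ≥ 1, and K n / n² → 0 as n → ∞. Then (1/n²) ∫ (max_{0≤k≤n} |M k|)² dμ → 0 as n → ∞; in particular (1/n) max_{0≤k≤n} |M k| → 0 in probability (in measure μ). -/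
open Filter Finset MeasureTheory

/-- The running maximum of the absolute values of a real process. -/
noncomputable def runningMaxAbs {Ω : Type*} (M : ℕ → Ω → ℝ) (n : ℕ) (ω : Ω) : ℝ :=
  (range (n + 1)).sup' nonempty_range_add_one (fun k => |M k ω|)

section RunningMaxAbs

variable {Ω : Type*} {M : ℕ → Ω → ℝ}

theorem runningMaxAbs_zero (ω : Ω) : runningMaxAbs M 0 ω = |M 0 ω| := by
  simp [runningMaxAbs]

theorem runningMaxAbs_succ (n : ℕ) (ω : Ω) :
    runningMaxAbs M (n + 1) ω = max |M (n + 1) ω| (runningMaxAbs M n ω) := by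
  simp only [runningMaxAbs, range_add_one (n := n + 1)]
  rw [sup'_insert]

theorem runningMaxAbs_nonneg (n : ℕ) (ω : Ω) : 0 ≤ runningMaxAbs M n ω :=
  (abs_nonneg (M 0 ω)).trans <|
    le_sup' (fun k => |M k ω|) (mem_range.mpr n.succ_pos)

variable {m0 : MeasurableSpace Ω} {μ : Measure Ω} {𝒢 : Filtration ℕ m0}

theorem measurable_runningMaxAbs (hM : ∀ n, Measurable[𝒢 n] (M n)) (n : ℕ) :
    Measurable[𝒢 n] (runningMaxAbs M n) := by
  induction n with
  | zero =>
    simp only [funext runningMaxAbs_zero]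
    exact continuous_abs.measurable.comp (hM 0)
  | succ n ih =>
    simp only [funext (runningMaxAbs_succ n)]
    exact (continuous_abs.measurable.comp (hM (n + 1))).max (ih.mono (𝒢.mono n.le_succ) le_rfl)

theorem memLp_runningMaxAbs {p : ENNReal} (hL : ∀ k, MemLp (M k) p μ) (n : ℕ) :
    MemLp (runningMaxAbs M n) p μ := by
  induction n with
  | zero =>
    simp only [funext runningMaxAbs_zero]
    exact (hL 0).abs
  | succ n ih =>
    simp only [funext (runningMaxAbs_succ n)]
    exact (hL (n + 1)).abs.sup ih

end RunningMaxAbs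

section Martingale

variable {Ω : Type*} {m0 : MeasurableSpace Ω} {μ : Measure Ω} [IsFiniteMeasure μ]
  {𝒢 : Filtration ℕ m0} {M : ℕ → Ω → ℝ}

/-- A square-integrable martingale increment is orthogonal to the past. -/
theorem MeasureTheory.Martingale.integral_mul_sub_eq_zero (hM : Martingale M 𝒢 μ)
    (hL2 : ∀ k, MemLp (M k) 2 μ) {n : ℕ} {g : Ω → ℝ} (hg : Measurable[𝒢 n] g)
    (hg2 : MemLp g 2 μ) :
    ∫ ω, g ω * (M (n + 1) ω - M n ω) ∂μ = 0 := by
  have hint : Integrable (g * (M (n + 1) - M n)) μ :=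
    hg2.integrable_mul ((hL2 (n + 1)).sub (hL2 n))
  have hcond : μ[M (n + 1) - M n | 𝒢 n] =ᵐ[μ] 0 := by
    filter_upwards [condExp_sub (hM.integrable (n + 1)) (hM.integrable n) (𝒢 n),
      hM.condExp_ae_eq n.le_succ, hM.condExp_ae_eq (le_refl n)] with ω h h₁ h₂
    rw [h, Pi.sub_apply, h₁, h₂, sub_self, Pi.zero_apply]
  have hpull := condExp_mul_of_stronglyMeasurable_left hg.stronglyMeasurable hint
    ((hM.integrable (n + 1)).sub (hM.integrable n))
  change ∫ ω, (g * (M (n + 1) - M n)) ω ∂μ = 0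
  rw [← integral_condExp (𝒢.le n)]
  refine integral_eq_zero_of_ae ?_
  filter_upwards [hpull, hcond] with ω h₁ h₂
  rw [h₁, Pi.mul_apply, h₂, Pi.zero_apply, mul_zero]

/-- The second moment of a martingale started at `0` is the sum of the second moments of its
increments. -/
theorem MeasureTheory.Martingale.integral_sq_eq_sum (hM : Martingale M 𝒢 μ) (hM0 : M 0 = 0)
    (hL2 : ∀ k, MemLp (M k) 2 μ) (n : ℕ) :
    ∫ ω, M n ω ^ 2 ∂μ = ∑ i ∈ Icc 1 n, ∫ ω, (M i ω - M (i - 1) ω) ^ 2 ∂μ := by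
  induction n with
  | zero => simp [hM0]
  | succ n ih =>
    rw [sum_Icc_succ_top (by omega), ← ih, Nat.add_sub_cancel]
    have horth := hM.integral_mul_sub_eq_zero hL2 (hM.stronglyMeasurable n).measurable (hL2 n)
    have hd : MemLp (fun ω => M (n + 1) ω - M n ω) 2 μ := (hL2 (n + 1)).sub (hL2 n)
    have hmul : Integrable (fun ω => M n ω * (M (n + 1) ω - M n ω)) μ :=
      (hL2 n).integrable_mul hd
    have hsplit : ∀ ω, M (n + 1) ω ^ 2 = M n ω ^ 2 + (M (n + 1) ω - M n ω) ^ 2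
        + 2 * (M n ω * (M (n + 1) ω - M n ω)) := fun ω => by ring
    have hsum : Integrable (fun ω => M n ω ^ 2 + (M (n + 1) ω - M n ω) ^ 2) μ :=
      (hL2 n).integrable_sq.add hd.integrable_sq
    simp only [hsplit]
    rw [integral_add hsum (hmul.const_mul 2),
      integral_add (hL2 n).integrable_sq hd.integrable_sq, integral_const_mul, horth,
      mul_zero, add_zero]

/-- With `S` the running maximum of `|M|`, the expectation of `2 * S n * |M n| - S n ^ 2` is
nonnegative: it is nondecreasing in `n`, since its increments dominate
`2 * S n * (|M (n + 1)| - |M n|)`. -/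
theorem MeasureTheory.Martingale.integral_two_mul_runningMaxAbs_mul_abs_sub_sq_nonneg
    (hM : Martingale M 𝒢 μ) (hL2 : ∀ k, MemLp (M k) 2 μ) (n : ℕ) :
    0 ≤ ∫ ω, (2 * (runningMaxAbs M n ω * |M n ω|) - runningMaxAbs M n ω ^ 2) ∂μ := by
  have hint : ∀ k, Integrable
      (fun ω => 2 * (runningMaxAbs M k ω * |M k ω|) - runningMaxAbs M k ω ^ 2) μ := fun k =>
    (((memLp_runningMaxAbs hL2 k).integrable_mul (hL2 k).abs).const_mul 2).sub
      (memLp_runningMaxAbs hL2 k).integrable_sq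
  induction n with
  | zero =>
    refine integral_nonneg fun ω => ?_
    rw [Pi.zero_apply, runningMaxAbs_zero]
    nlinarith [sq_nonneg |M 0 ω|]
  | succ n ih =>
    let g : Ω → ℝ := fun ω => if 0 ≤ M n ω then runningMaxAbs M n ω else -runningMaxAbs M n ω
    have hMn := (hM.stronglyMeasurable n).measurable
    have hS := measurable_runningMaxAbs (fun k => (hM.stronglyMeasurable k).measurable) n
    have hg : Measurable[𝒢 n] g := by
      refine Measurable.ite ?_ hS hS.neg
      exact hMn measurableSet_Ici
    have hg2 : MemLp g 2 μ := by
      refine (memLp_runningMaxAbs hL2 n).of_le (hg.mono (𝒢.le n) le_rfl).aestronglyMeasurable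
        (ae_of_all _ fun ω => ?_)
      dsimp only [g]
      split_ifs <;> simp
    have hgi : Integrable (fun ω => g ω * (M (n + 1) ω - M n ω)) μ :=
      hg2.integrable_mul ((hL2 (n + 1)).sub (hL2 n))
    have horth := hM.integral_mul_sub_eq_zero hL2 hg hg2
    refine ih.trans ?_
    calc _ = ∫ ω, ((2 * (runningMaxAbs M n ω * |M n ω|) - runningMaxAbs M n ω ^ 2)
          + 2 * (g ω * (M (n + 1) ω - M n ω))) ∂μ := by
            rw [integral_add (hint n) (hgi.const_mul 2), integral_const_mul, horth, mul_zero,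
              add_zero]
      _ ≤ _ := by
        refine integral_mono ((hint n).add (hgi.const_mul 2)) (hint (n + 1)) fun ω => ?_
        have hS0 := runningMaxAbs_nonneg (M := M) n ω
        have hsign : g ω * (M (n + 1) ω - M n ω) ≤
            runningMaxAbs M n ω * (|M (n + 1) ω| - |M n ω|) := by
          dsimp only [g]
          split_ifs with h
          · rw [abs_of_nonneg h]
            exact mul_le_mul_of_nonneg_left (by linarith [le_abs_self (M (n + 1) ω)]) hS0
          · rw [abs_of_neg (not_le.mp h), neg_mul, ← mul_neg]
            exact mul_le_mul_of_nonneg_left (by linarith [neg_le_abs (M (n + 1) ω)]) hS0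
        dsimp only
        rw [runningMaxAbs_succ]
        rcases le_total |M (n + 1) ω| (runningMaxAbs M n ω) with h | h
        · rw [max_eq_right h]
          linarith
        · rw [max_eq_left h]
          nlinarith [sq_nonneg (|M (n + 1) ω| - runningMaxAbs M n ω)]

/-- **Doob's `L²` inequality** for square-integrable martingales. -/
theorem MeasureTheory.Martingale.integral_runningMaxAbs_sq_le (hM : Martingale M 𝒢 μ)
    (hL2 : ∀ k, MemLp (M k) 2 μ) (n : ℕ) :
    ∫ ω, runningMaxAbs M n ω ^ 2 ∂μ ≤ 4 * ∫ ω, M n ω ^ 2 ∂μ := by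
  have hS := memLp_runningMaxAbs hL2 n
  have hnonneg := hM.integral_two_mul_runningMaxAbs_mul_abs_sub_sq_nonneg hL2 n
  have hle : ∫ ω, (2 * (runningMaxAbs M n ω * |M n ω|) - runningMaxAbs M n ω ^ 2) ∂μ ≤
      ∫ ω, (2 * M n ω ^ 2 - 1 / 2 * runningMaxAbs M n ω ^ 2) ∂μ := by
    refine integral_mono (((hS.integrable_mul (hL2 n).abs).const_mul 2).sub hS.integrable_sq)
      (((hL2 n).integrable_sq.const_mul 2).sub (hS.integrable_sq.const_mul _)) fun ω => ?_
    dsimp only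
    rw [← sq_abs (M n ω)]
    nlinarith [sq_nonneg (runningMaxAbs M n ω - 2 * |M n ω|)]
  rw [integral_sub ((hL2 n).integrable_sq.const_mul 2) (hS.integrable_sq.const_mul _),
    integral_const_mul, integral_const_mul] at hle
  linarith

end Martingale

/-- Maximal-inequality step in the proof of Lemma 3: a discrete real-valued
square-integrable martingale started at `0` whose cumulative increment variances
grow slower than `n²` satisfies `(1/n²) E[(max_{k≤n} |M k|)²] → 0`, and hence
`(1/n) max_{k≤n} |M k| → 0` in probability. -/
theorem martingale_max_sq_div_n_sq_tendsto_zero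
    {Ω : Type*} {m0 : MeasurableSpace Ω} (μ : Measure Ω) [IsProbabilityMeasure μ]
    (𝒢 : Filtration ℕ m0) (M : ℕ → Ω → ℝ)
    (hM : Martingale M 𝒢 μ) (hM0 : M 0 = 0)
    (hL2 : ∀ k : ℕ, MemLp (M k) 2 μ)
    (K : ℕ → ℝ)
    (hK : ∀ n : ℕ, 1 ≤ n →
      ∑ i ∈ Icc 1 n, ∫ ω, (M i ω - M (i - 1) ω) ^ 2 ∂μ ≤ K n)
    (hKn : Tendsto (fun n : ℕ => K n / (n : ℝ) ^ 2) atTop (nhds 0)) :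
    Tendsto (fun n : ℕ =>
        (1 / (n : ℝ) ^ 2) *
          ∫ ω, ((range (n + 1)).sup' nonempty_range_add_one (fun k => |M k ω|)) ^ 2 ∂μ)
      atTop (nhds 0) ∧
    TendstoInMeasure μ
      (fun (n : ℕ) (ω : Ω) => (1 / (n : ℝ)) *
        (range (n + 1)).sup' nonempty_range_add_one (fun k => |M k ω|))
      atTop (fun _ => 0) := by
  have hsq : Tendsto (fun n : ℕ => (1 / (n : ℝ) ^ 2) * ∫ ω, runningMaxAbs M n ω ^ 2 ∂μ)
      atTop (nhds 0) := by
    have hlim : Tendsto (fun n : ℕ => 4 * (K n / (n : ℝ) ^ 2)) atTop (nhds 0) := by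
      simpa using hKn.const_mul 4
    refine squeeze_zero' (Eventually.of_forall fun n => ?_) ?_ hlim
    · exact mul_nonneg (by positivity) (integral_nonneg fun ω => sq_nonneg _)
    · filter_upwards [eventually_ge_atTop 1] with n hn
      have hbound := (hM.integral_runningMaxAbs_sq_le hL2 n).trans
        (mul_le_mul_of_nonneg_left ((hM.integral_sq_eq_sum hM0 hL2 n).trans_le (hK n hn))
          zero_le_four)
      calc _ ≤ 1 / (n : ℝ) ^ 2 * (4 * K n) := mul_le_mul_of_nonneg_left hbound (by positivity)
        _ = _ := by ring
  refine ⟨hsq, ?_⟩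
  change TendstoInMeasure μ (fun (n : ℕ) ω => (1 / (n : ℝ)) * runningMaxAbs M n ω) atTop
    (fun _ => 0)
  have hmem : ∀ n : ℕ, MemLp (fun ω => (1 / (n : ℝ)) * runningMaxAbs M n ω) 2 μ := fun n =>
    (memLp_runningMaxAbs hL2 n).const_mul _
  refine tendstoInMeasure_of_tendsto_eLpNorm two_ne_zero
    (fun n => (hmem n).aestronglyMeasurable) aestronglyMeasurable_const ?_
  have hnorm : ∀ n : ℕ,
      eLpNorm ((fun ω => (1 / (n : ℝ)) * runningMaxAbs M n ω) - fun _ => 0) 2 μ =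
        ENNReal.ofReal (((1 / (n : ℝ) ^ 2) * ∫ ω, runningMaxAbs M n ω ^ 2 ∂μ) ^ (2⁻¹ : ℝ)) := by
    intro n
    have hsub : ((fun ω => (1 / (n : ℝ)) * runningMaxAbs M n ω) - fun _ => 0) =
        fun ω => (1 / (n : ℝ)) * runningMaxAbs M n ω := funext fun ω => sub_zero _
    rw [hsub, (hmem n).eLpNorm_eq_integral_rpow_norm two_ne_zero ENNReal.ofNat_ne_top,
      ← integral_const_mul]
    simp [mul_pow]
  simp only [hnorm]
  simpa using ENNReal.tendsto_ofReal (hsq.rpow_const (p := (2⁻¹ : ℝ)) (Or.inr (by norm_num)))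
end

section
/- Let (Ω, ℱ, μ) be a probability space. For each n ≥ 1 let ξ n 1, …, ξ n n be real-valued random variables on Ω, let b : ℕ → ℝ satisfy b n > 0 and n · b n → ∞, let t ∈ (0,1), and let F₁ ≠ F₂ be real numbers. Assume that (1/(⌊n·t⌋ · b n)) ∑_{i=1}^{⌊n·t⌋} ξ n i → F₁ in probability and (1/((n − ⌊n·t⌋) · b n)) ∑_{i=⌊n·t⌋+1}^{n} ξ n i → F₂ in probability as n → ∞. Then for every real M, μ( (1/√(n · b n)) · max_{1≤k≤n} |∑_{i=1}^k ξ n i − (k/n) ∑_{i=1}^n ξ n i| > M ) → 1 as n → ∞. -/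
open Filter Finset MeasureTheory

/-- The cusum at an interior time `m` is a multiple of the difference of the normalized block
averages before and after `m`. -/
lemma cusum_eq_mul_sub_block_averages (x : ℕ → ℝ) {m n : ℕ} (hm : 0 < m) (hmn : m < n)
    {β : ℝ} (hβ : 0 < β) :
    (∑ i ∈ Icc 1 m, x i) - ((m : ℝ) / n) * ∑ i ∈ Icc 1 n, x i =
      (m : ℝ) * (n - m) / n * β *
        (1 / (m * β) * ∑ i ∈ Icc 1 m, x i -
          1 / (((n : ℝ) - m) * β) * ∑ i ∈ Icc (m + 1) n, x i) := by
  have hsplit : ∑ i ∈ Icc 1 n, x i = ∑ i ∈ Icc 1 m, x i + ∑ i ∈ Icc (m + 1) n, x i := by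
    rw [← sum_union]
    · congr 1
      ext i
      simp only [mem_Icc, mem_union]
      omega
    · rw [disjoint_left]
      intro i
      simp only [mem_Icc]
      omega
  have hm' : (0 : ℝ) < m := by exact_mod_cast hm
  have hmn' : (0 : ℝ) < n - m := sub_pos.2 (by exact_mod_cast hmn)
  have hn' : (0 : ℝ) < n := by linarith
  rw [hsplit]
  field_simp
  ring

/-- If two sequences of events have vanishing probability, then any sequence of events that
eventually contains the complement of their union has probability tending to one. No
measurability is required. -/
lemma tendsto_measure_one_of_compl_union_subset {Ω : Type*} [MeasurableSpace Ω] {μ : Measure Ω}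
    [IsProbabilityMeasure μ] {A B C : ℕ → Set Ω}
    (hA : Tendsto (fun n => μ (A n)) atTop (nhds 0))
    (hB : Tendsto (fun n => μ (B n)) atTop (nhds 0))
    (h : ∀ᶠ n in atTop, (A n ∪ B n)ᶜ ⊆ C n) :
    Tendsto (fun n => μ (C n)) atTop (nhds 1) := by
  have hlow : Tendsto (fun n => 1 - (μ (A n) + μ (B n))) atTop (nhds 1) := by
    simpa using ENNReal.Tendsto.sub tendsto_const_nhds (hA.add hB) (Or.inl ENNReal.one_ne_top)
  refine tendsto_of_tendsto_of_tendsto_of_le_of_le' hlow tendsto_const_nhds ?_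
    (Eventually.of_forall fun n => prob_le_one)
  filter_upwards [h] with n hn
  rw [tsub_le_iff_right]
  calc (1 : ENNReal) = μ Set.univ := measure_univ.symm
    _ ≤ μ (C n ∪ (A n ∪ B n)) := measure_mono fun ω _ => by
        by_cases hω : ω ∈ A n ∪ B n
        · exact Or.inr hω
        · exact Or.inl (hn hω)
    _ ≤ μ (C n) + μ (A n ∪ B n) := measure_union_le _ _
    _ ≤ μ (C n) + (μ (A n) + μ (B n)) := by gcongr; exact measure_union_le _ _

/-- If the normalized block averages before and after `m` differ by at least `δ`, and both blocks
occupy at least the fractions `p` and `q` of the sample, then the normalized cusum maximum is at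
least `p * q * δ * √(n * β)`. -/
lemma le_cusum_statistic (x : ℕ → ℝ) {m n : ℕ} (hm : 0 < m) (hmn : m < n) {β p q δ : ℝ}
    (hβ : 0 < β) (hq : 0 ≤ q) (hδ : 0 ≤ δ) (hpm : p * n ≤ m)
    (hqm : q * n ≤ n - m)
    (hdiff : δ ≤ |1 / (m * β) * ∑ i ∈ Icc 1 m, x i -
      1 / (((n : ℝ) - m) * β) * ∑ i ∈ Icc (m + 1) n, x i|) :
    p * q * δ * √(n * β) ≤ (1 / √(n * β)) *
      sSup ((fun k : ℕ => |(∑ i ∈ Icc 1 k, x i) - ((k : ℝ) / n) * ∑ i ∈ Icc 1 n, x i|) ''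
        Set.Icc 1 n) := by
  have hn : (0 : ℝ) < n := by exact_mod_cast hm.trans hmn
  have hnβ : 0 < n * β := mul_pos hn hβ
  have hpq : p * q * (n * β) ≤ (m : ℝ) * (n - m) / n * β := by
    have hprod : p * n * (q * n) ≤ m * (n - m) :=
      mul_le_mul hpm hqm (by positivity) (by positivity)
    calc p * q * (n * β) = p * n * (q * n) / n * β := by field_simp
      _ ≤ _ := by gcongr
  have hcusum : p * q * (n * β) * δ ≤
      |(∑ i ∈ Icc 1 m, x i) - ((m : ℝ) / n) * ∑ i ∈ Icc 1 n, x i| := by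
    rw [cusum_eq_mul_sub_block_averages x hm hmn hβ, abs_mul]
    exact mul_le_mul (hpq.trans (le_abs_self _)) hdiff hδ (abs_nonneg _)
  have hsup := hcusum.trans (le_csSup (((Set.finite_Icc 1 n).image _).bddAbove)
    (Set.mem_image_of_mem (fun k : ℕ =>
      |(∑ i ∈ Icc 1 k, x i) - ((k : ℝ) / n) * ∑ i ∈ Icc 1 n, x i|)
      (show m ∈ Set.Icc 1 n from ⟨hm, hmn.le⟩)))
  calc p * q * δ * √(n * β) = 1 / √(n * β) * (p * q * (√(n * β) * √(n * β)) * δ) := by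
        have := Real.sqrt_pos.2 hnβ
        field_simp
    _ = 1 / √(n * β) * (p * q * (n * β) * δ) := by rw [Real.mul_self_sqrt hnβ.le]
    _ ≤ _ := by gcongr

/-- Common divergence mechanism underlying Theorems 4, 5 and 6: if normalized block
averages before and after the change point `⌊n·t⌋` converge in probability to two
distinct constants, then the normalized cusum maximum statistic diverges to infinity
in probability. -/
theorem cusum_statistic_diverges
    {Ω : Type*} [MeasurableSpace Ω] (μ : Measure Ω) [IsProbabilityMeasure μ]
    (ξ : ℕ → ℕ → Ω → ℝ) (b : ℕ → ℝ) (hb : ∀ n, 0 < b n)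
    (hnb : Tendsto (fun n : ℕ => (n : ℝ) * b n) atTop atTop)
    (t : ℝ) (ht0 : 0 < t) (ht1 : t < 1) (F₁ F₂ : ℝ) (hF : F₁ ≠ F₂)
    (h1 : TendstoInMeasure μ
      (fun (n : ℕ) (ω : Ω) =>
        (1 / ((⌊(n : ℝ) * t⌋₊ : ℝ) * b n)) * ∑ i ∈ Icc 1 ⌊(n : ℝ) * t⌋₊, ξ n i ω)
      atTop (fun _ => F₁))
    (h2 : TendstoInMeasure μ
      (fun (n : ℕ) (ω : Ω) =>
        (1 / (((n : ℝ) - (⌊(n : ℝ) * t⌋₊ : ℝ)) * b n)) *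
          ∑ i ∈ Icc (⌊(n : ℝ) * t⌋₊ + 1) n, ξ n i ω)
      atTop (fun _ => F₂)) :
    ∀ M : ℝ, Tendsto (fun n : ℕ =>
      μ {ω | M < (1 / Real.sqrt ((n : ℝ) * b n)) *
          sSup ((fun k : ℕ =>
            |(∑ i ∈ Icc 1 k, ξ n i ω) -
              ((k : ℝ) / (n : ℝ)) * ∑ i ∈ Icc 1 n, ξ n i ω|) '' Set.Icc 1 n)})
      atTop (nhds 1) := by
  intro M
  have hd : 0 < |F₁ - F₂| := abs_pos.2 (sub_ne_zero.2 hF)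
  rw [tendstoInMeasure_iff_dist] at h1 h2
  refine tendsto_measure_one_of_compl_union_subset (h1 (|F₁ - F₂| / 4) (by positivity))
    (h2 (|F₁ - F₂| / 4) (by positivity)) ?_
  have hc : 0 < t / 2 * (1 - t) * (|F₁ - F₂| / 2) := by
    have := sub_pos.2 ht1
    positivity
  have hdiv := (Real.tendsto_sqrt_atTop.comp hnb).const_mul_atTop hc
  have hnt : Tendsto (fun n : ℕ => (n : ℝ) * t) atTop atTop :=
    tendsto_natCast_atTop_atTop.atTop_mul_const ht0
  filter_upwards [hdiv.eventually_gt_atTop M, hnt.eventually_ge_atTop 2] with n hM hn2 ω hω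
  simp only [Set.mem_compl_iff, Set.mem_union, Set.mem_ofPred_eq, not_or, not_le,
    Real.dist_eq] at hω
  have hn : (0 : ℝ) < n := pos_of_mul_pos_left (by linarith) ht0.le
  have hfloor_le : (⌊(n : ℝ) * t⌋₊ : ℝ) ≤ n * t := Nat.floor_le (by positivity)
  have hlt_floor : (n : ℝ) * t < ⌊(n : ℝ) * t⌋₊ + 1 := Nat.lt_floor_add_one _
  have hfloor_pos : 0 < ⌊(n : ℝ) * t⌋₊ := Nat.floor_pos.2 (by linarith)
  have hfloor_lt : ⌊(n : ℝ) * t⌋₊ < n := by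
    have : (⌊(n : ℝ) * t⌋₊ : ℝ) < n := by nlinarith
    exact_mod_cast this
  refine hM.trans_le (le_cusum_statistic (fun i => ξ n i ω) hfloor_pos hfloor_lt (hb n)
    (by linarith) (by linarith) (by linarith) (by linarith) ?_)
  obtain ⟨hω1, hω2⟩ := hω
  generalize (1 / ((⌊(n : ℝ) * t⌋₊ : ℝ) * b n)) * ∑ i ∈ Icc 1 ⌊(n : ℝ) * t⌋₊, ξ n i ω = a₁ at *
  generalize (1 / (((n : ℝ) - (⌊(n : ℝ) * t⌋₊ : ℝ)) * b n)) *
    ∑ i ∈ Icc (⌊(n : ℝ) * t⌋₊ + 1) n, ξ n i ω = a₂ at *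
  have htri : |F₁ - F₂| ≤ |a₁ - F₁| + |a₁ - a₂| + |a₂ - F₂| := by
    rw [abs_sub_comm a₁ F₁]
    calc |F₁ - F₂| = |(F₁ - a₁) + (a₁ - a₂) + (a₂ - F₂)| := by ring_nf
      _ ≤ _ := abs_add_three _ _ _
  linarith
end
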